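/- Under assumptions (A1)–(A4), let c be the unique fixed point of f₀∘f₁ in [1−x₀, y₀]. There exists ρ > 0 such that for every x, y ∈ (c−ρ, c+ρ) the measures ℙ_x and ℙ_y on Σ are mutually absolutely continuous (ℙ_x ≪ ℙ_y and ℙ_y ≪ ℙ_x). -/

import Mathlib

/-
Formalization of the Alsedà–Misiurewicz system setup:
`f0, f1` are the piecewise-linear interval homeomorphisms, `iter` the random
iteration along ω ∈ Σ = {0,1}^ℕ, `IsKernel` characterises the family x ↦ ℙ_x by
its values on cylinder sets, `Pop` is the Markov operator (as a set function),
`Stationary` expresses P-invariance for probability measures on (0,1), `U` is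
the dual operator, and `A1`–`A4` are the assumptions of the paper.
-/

open MeasureTheory Filter Set
open scoped ENNReal Topology

namespace AM

noncomputable def f0 (x₀ y₀ : ℝ) (x : ℝ) : ℝ :=
  if x ≤ x₀ then (y₀ / x₀) * x else ((1 - y₀) / (1 - x₀)) * (x - 1) + 1

noncomputable def f1 (x₀ y₀ : ℝ) (x : ℝ) : ℝ := 1 - f0 x₀ y₀ (1 - x)

/-- `fb b` is `f₁` if `b = true`, and `f₀` if `b = false`. -/
noncomputable def fb (x₀ y₀ : ℝ) (b : Bool) : ℝ → ℝ :=
  if b then f1 x₀ y₀ else f0 x₀ y₀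

/-- `iter x₀ y₀ ω n x = f^n_ω(x) = f_{ω (n-1)} ∘ ⋯ ∘ f_{ω 0} (x)`, with `f^0_ω = id`. -/
noncomputable def iter (x₀ y₀ : ℝ) (ω : ℕ → Bool) : ℕ → ℝ → ℝ
  | 0, x => x
  | n + 1, x => fb x₀ y₀ (ω n) (iter x₀ y₀ ω n x)

/-- `cylProb x₀ y₀ p₀ p₁ x w = p_{i₁}(x) p_{i₂}(f_{i₁} x) ⋯` for the word `w = (i₁, …, i_k)`. -/
noncomputable def cylProb (x₀ y₀ : ℝ) (p₀ p₁ : ℝ → ℝ) : ℝ → List Bool → ℝ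
  | _, [] => 1
  | x, b :: w => (if b then p₁ x else p₀ x) * cylProb x₀ y₀ p₀ p₁ (fb x₀ y₀ b x) w

/-- The cylinder set of sequences starting with the word `w`. -/
def cyl (w : List Bool) : Set (ℕ → Bool) := {ω | ∀ j : Fin w.length, ω j = w.get j}

/-- `IsKernel x₀ y₀ p₀ p₁ Pm` says that `Pm x = ℙ_x` for all `x ∈ (0,1)`, i.e. `Pm x` gives
every cylinder set its prescribed probability (this determines `Pm x` uniquely and makes it a
probability measure, since the empty word gives `Pm x univ = 1`). -/
def IsKernel (x₀ y₀ : ℝ) (p₀ p₁ : ℝ → ℝ) (Pm : ℝ → Measure (ℕ → Bool)) : Prop :=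
  ∀ x ∈ Ioo (0:ℝ) 1, ∀ w : List Bool,
    Pm x (cyl w) = ENNReal.ofReal (cylProb x₀ y₀ p₀ p₁ x w)

/-- The Markov operator `P`, as a set function:
`Pop μ A = ∫_{f₀⁻¹(A)} p₀ dμ + ∫_{f₁⁻¹(A)} p₁ dμ`. -/
noncomputable def Pop (x₀ y₀ : ℝ) (p₀ p₁ : ℝ → ℝ) (μ : Measure ℝ) (A : Set ℝ) : ℝ≥0∞ :=
  (∫⁻ x in f0 x₀ y₀ ⁻¹' A, ENNReal.ofReal (p₀ x) ∂μ) +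
    ∫⁻ x in f1 x₀ y₀ ⁻¹' A, ENNReal.ofReal (p₁ x) ∂μ

/-- A stationary (P-invariant) Borel probability measure on (0,1). -/
def Stationary (x₀ y₀ : ℝ) (p₀ p₁ : ℝ → ℝ) (μ : Measure ℝ) : Prop :=
  IsProbabilityMeasure μ ∧ μ (Ioo 0 1) = 1 ∧
    ∀ A : Set ℝ, MeasurableSet A → A ⊆ Ioo 0 1 → μ A = Pop x₀ y₀ p₀ p₁ μ A

/-- The dual operator `Uφ(x) = p₀(x) φ(f₀ x) + p₁(x) φ(f₁ x)`. -/
noncomputable def U (x₀ y₀ : ℝ) (p₀ p₁ : ℝ → ℝ) (φ : ℝ → ℝ) : ℝ → ℝ :=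
  fun x => p₀ x * φ (f0 x₀ y₀ x) + p₁ x * φ (f1 x₀ y₀ x)

/-- Assumption (A1): `1/2 < x₀ < 1` and `1/2 ≤ y₀ < x₀`. -/
def A1 (x₀ y₀ : ℝ) : Prop := 1/2 < x₀ ∧ x₀ < 1 ∧ 1/2 ≤ y₀ ∧ y₀ < x₀

/-- Assumption (A2): Dini continuity of `p₀, p₁`; `β` is a modulus of continuity for both, with
`∑ₙ β(C tⁿ) < ∞` for all `C ≥ 0`, `0 < t < 1`. (Such a `β` exists iff the least modulus of
continuity has this summability property.) -/
def A2 (p₀ p₁ : ℝ → ℝ) : Prop :=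
  ∃ β : ℝ → ℝ,
    (∀ t : ℝ, ∀ x ∈ Icc (0:ℝ) 1, ∀ y ∈ Icc (0:ℝ) 1, |x - y| ≤ t →
      |p₀ x - p₀ y| ≤ β t ∧ |p₁ x - p₁ y| ≤ β t) ∧
    (∀ C : ℝ, 0 ≤ C → ∀ t : ℝ, 0 < t → t < 1 → Summable fun n : ℕ => β (C * t ^ n))

/-- Assumption (A3): `p₀, p₁` are continuous, `p₀ + p₁ = 1`, and `0 < pᵢ < 1` on `[0,1]`. -/
def A3 (p₀ p₁ : ℝ → ℝ) : Prop :=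
  ContinuousOn p₀ (Icc 0 1) ∧ ContinuousOn p₁ (Icc 0 1) ∧
    ∀ x ∈ Icc (0:ℝ) 1, p₀ x + p₁ x = 1 ∧ 0 < p₀ x ∧ p₀ x < 1 ∧ 0 < p₁ x ∧ p₁ x < 1

/-- Assumption (A4): the average Lyapunov exponents at 0 and 1 are positive
(`a₀ = y₀/x₀`, `a₁ = (1-y₀)/(1-x₀)`). -/
def A4 (x₀ y₀ : ℝ) (p₀ p₁ : ℝ → ℝ) : Prop :=
  0 < p₀ 0 * Real.log (y₀ / x₀) + p₁ 0 * Real.log ((1 - y₀) / (1 - x₀)) ∧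
    0 < p₀ 1 * Real.log ((1 - y₀) / (1 - x₀)) + p₁ 1 * Real.log (y₀ / x₀)


/-! ### The logarithmic coordinate on `(0,1)` -/

/-- The coordinate `log (2u)` for `u ≤ 1/2`, `-log (2(1-u))` for `u ≥ 1/2`, in which both maps
`f0` and `f1` are nonexpansive. -/
noncomputable def coord (u : ℝ) : ℝ :=
  Real.log (min (2 * u) 1) - Real.log (min (2 * (1 - u)) 1)

lemma coord_one_sub (u : ℝ) : coord (1 - u) = -coord u := by
  simp [coord]

lemma coord_of_le {u : ℝ} (hu : u ≤ 1 / 2) : coord u = Real.log (2 * u) := by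
  rw [coord, min_eq_left (by linarith), min_eq_right (by linarith)]; simp

lemma coord_of_ge {u : ℝ} (hu : 1 / 2 ≤ u) : coord u = -Real.log (2 * (1 - u)) := by
  rw [coord, min_eq_right (by linarith), min_eq_left (by linarith)]; simp

lemma coord_half : coord (1 / 2) = 0 := by
  rw [coord_of_le le_rfl]; norm_num

lemma continuousAt_coord {c : ℝ} (hc : c ∈ Ioo (0 : ℝ) 1) : ContinuousAt coord c := by
  have h1 : 0 < min (2 * c) 1 := lt_min (by linarith [hc.1]) one_pos
  have h2 : 0 < min (2 * (1 - c)) 1 := lt_min (by linarith [hc.2]) one_pos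
  unfold coord
  refine ContinuousAt.sub (ContinuousAt.log (by fun_prop) h1.ne')
    (ContinuousAt.log (by fun_prop) h2.ne')

lemma sub_div_le_log_sub_log {a b : ℝ} (hb : 0 < b) (hab : b ≤ a) :
    (a - b) / a ≤ Real.log a - Real.log b := by
  have ha : 0 < a := hb.trans_le hab
  rw [← Real.log_div ha.ne' hb.ne']
  have := Real.one_sub_inv_le_log_of_pos (div_pos ha hb)
  rw [inv_div] at this
  rwa [sub_div, div_self ha.ne']

lemma log_sub_log_le_sub_div {a b : ℝ} (hb : 0 < b) (hab : b ≤ a) :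
    Real.log a - Real.log b ≤ (a - b) / b := by
  have ha : 0 < a := hb.trans_le hab
  rw [← Real.log_div ha.ne' hb.ne']
  have := Real.log_le_sub_one_of_pos (div_pos ha hb)
  rwa [sub_div, div_self hb.ne']

lemma sub_le_coord_sub {x y : ℝ} (hx : 0 < x) (hy : y < 1) (hxy : x ≤ y) :
    y - x ≤ coord y - coord x := by
  have key : ∀ a b : ℝ, 0 < b → b ≤ a → a ≤ 1 → a - b ≤ Real.log a - Real.log b := by
    intro a b hb hab ha
    refine le_trans ?_ (sub_div_le_log_sub_log hb hab)
    rw [le_div_iff₀ (hb.trans_le hab)]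
    nlinarith
  have h1 := key (min (2 * y) 1) (min (2 * x) 1) (lt_min (by linarith) one_pos)
    (min_le_min (by linarith) le_rfl) (min_le_right _ _)
  have h2 := key (min (2 * (1 - x)) 1) (min (2 * (1 - y)) 1) (lt_min (by linarith) one_pos)
    (min_le_min (by linarith) le_rfl) (min_le_right _ _)
  have h3 : ∀ u : ℝ, min (2 * u) 1 - min (2 * (1 - u)) 1 = 2 * u - 1 := by
    intro u
    rcases le_total u (1 / 2) with h | h
    · rw [min_eq_left (by linarith), min_eq_right (by linarith)]
    · rw [min_eq_right (by linarith), min_eq_left (by linarith)]; ring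
  have h4 := h3 x
  have h5 := h3 y
  unfold coord
  linarith

lemma abs_sub_le_abs_coord_sub {x y : ℝ} (hx : x ∈ Ioo (0 : ℝ) 1) (hy : y ∈ Ioo (0 : ℝ) 1) :
    |x - y| ≤ |coord x - coord y| := by
  rcases le_total x y with h | h
  · have := sub_le_coord_sub hx.1 hy.2 h
    rw [abs_sub_comm, abs_sub_comm (coord x), abs_of_nonneg (by linarith)]
    exact this.trans (le_abs_self _)
  · have := sub_le_coord_sub hy.1 hx.2 h
    rw [abs_of_nonneg (by linarith)]
    exact this.trans (le_abs_self _)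

lemma coord_le_coord_iff {x y : ℝ} (hx : x ∈ Ioo (0 : ℝ) 1) (hy : y ∈ Ioo (0 : ℝ) 1) :
    coord x ≤ coord y ↔ x ≤ y := by
  constructor
  · intro h
    by_contra! hlt
    have := sub_le_coord_sub hy.1 hx.2 hlt.le
    linarith
  · intro h
    have := sub_le_coord_sub hx.1 hy.2 h
    linarith

section Dynamics

variable {x₀ y₀ : ℝ}

lemma A1.ratio_pos (h : A1 x₀ y₀) : 0 < y₀ / x₀ := by
  obtain ⟨h1, h2, h3, h4⟩ := h
  exact div_pos (by linarith) (by linarith)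

lemma A1.ratio_lt_one (h : A1 x₀ y₀) : y₀ / x₀ < 1 := by
  obtain ⟨h1, h2, h3, h4⟩ := h
  rw [div_lt_one (by linarith)]; exact h4

lemma f0_of_le {x : ℝ} (hx : x ≤ x₀) : f0 x₀ y₀ x = y₀ / x₀ * x := if_pos hx

lemma A1.one_sub_f0 (h : A1 x₀ y₀) {x : ℝ} (hx : x₀ ≤ x) :
    1 - f0 x₀ y₀ x = (1 - y₀) / (1 - x₀) * (1 - x) := by
  obtain ⟨h1, h2, h3, h4⟩ := h
  rcases hx.eq_or_lt with rfl | hx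
  · rw [f0_of_le le_rfl, div_mul_cancel₀ _ (by linarith), div_mul_cancel₀ _ (by linarith)]
  · rw [f0, if_neg (by linarith)]; ring

lemma A1.f0_mono (h : A1 x₀ y₀) : Monotone (f0 x₀ y₀) := by
  have ha := h.ratio_pos
  have hb : 0 < (1 - y₀) / (1 - x₀) :=
    div_pos (by linarith [h.2.1, h.2.2.2]) (by linarith [h.2.1])
  intro x y hxy
  have left : ∀ {x y : ℝ}, x ≤ y → y ≤ x₀ → f0 x₀ y₀ x ≤ f0 x₀ y₀ y := by
    intro x y hxy hy
    rw [f0_of_le hy, f0_of_le (hxy.trans hy)]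
    gcongr
  have right : ∀ {x y : ℝ}, x ≤ y → x₀ ≤ x → f0 x₀ y₀ x ≤ f0 x₀ y₀ y := by
    intro x y hxy hx
    have h1 := h.one_sub_f0 hx
    have h2 := h.one_sub_f0 (hx.trans hxy)
    nlinarith
  rcases le_total y x₀ with hy | hy
  · exact left hxy hy
  rcases le_total x x₀ with hx | hx
  · exact (left hx le_rfl).trans (right hy le_rfl)
  · exact right hxy hx

lemma A1.f0_mem (h : A1 x₀ y₀) {x : ℝ} (hx : x ∈ Ioo (0 : ℝ) 1) : f0 x₀ y₀ x ∈ Ioo (0 : ℝ) 1 := by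
  have ha := h.ratio_pos
  have ha' := h.ratio_lt_one
  have hb : 0 < (1 - y₀) / (1 - x₀) :=
    div_pos (by linarith [h.2.1, h.2.2.2]) (by linarith [h.2.1])
  have hx₀ : f0 x₀ y₀ x₀ = y₀ := by
    rw [f0_of_le le_rfl, div_mul_cancel₀ _ (by linarith [h.1])]
  obtain ⟨h1, h2, h3, h4⟩ := id h
  rcases le_total x x₀ with hxx | hxx
  · refine ⟨?_, ?_⟩
    · rw [f0_of_le hxx]; exact mul_pos ha hx.1
    · have := h.f0_mono hxx
      linarith
  · have := h.f0_mono hxx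
    have h5 := h.one_sub_f0 hxx
    have : 0 < (1 - y₀) / (1 - x₀) * (1 - x) := mul_pos hb (by linarith [hx.2])
    exact ⟨by linarith, by linarith⟩

lemma one_sub_mem {x : ℝ} (hx : x ∈ Ioo (0 : ℝ) 1) : 1 - x ∈ Ioo (0 : ℝ) 1 :=
  ⟨by linarith [hx.2], by linarith [hx.1]⟩

lemma A1.f1_mem (h : A1 x₀ y₀) {x : ℝ} (hx : x ∈ Ioo (0 : ℝ) 1) : f1 x₀ y₀ x ∈ Ioo (0 : ℝ) 1 :=
  one_sub_mem (h.f0_mem (one_sub_mem hx))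

lemma A1.fb_mem (h : A1 x₀ y₀) (b : Bool) {x : ℝ} (hx : x ∈ Ioo (0 : ℝ) 1) :
    fb x₀ y₀ b x ∈ Ioo (0 : ℝ) 1 := by
  cases b
  · exact h.f0_mem hx
  · exact h.f1_mem hx

lemma coord_f1 (x : ℝ) : coord (f1 x₀ y₀ x) = -coord (f0 x₀ y₀ (1 - x)) := by
  rw [f1, coord_one_sub]

lemma A1.mem_left (h : A1 x₀ y₀) : x₀ ∈ Ioo (0 : ℝ) 1 := ⟨by linarith [h.1], h.2.1⟩

lemma A1.coord_f0_of_le_half (h : A1 x₀ y₀) {x : ℝ} (hx : 0 < x) (hx' : x ≤ 1 / 2) :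
    coord (f0 x₀ y₀ x) = coord x + Real.log (y₀ / x₀) := by
  have ha := h.ratio_pos
  have ha' := h.ratio_lt_one
  rw [f0_of_le (by linarith [h.1]), coord_of_le hx', coord_of_le (by nlinarith),
    mul_left_comm, Real.log_mul ha.ne' (by positivity), add_comm]

lemma A1.coord_f0_of_ge (h : A1 x₀ y₀) {x : ℝ} (hx : x₀ ≤ x) (hx' : x < 1) :
    coord (f0 x₀ y₀ x) = coord x - Real.log ((1 - y₀) / (1 - x₀)) := by
  have hx₀ : f0 x₀ y₀ x₀ = y₀ := by
    rw [f0_of_le le_rfl, div_mul_cancel₀ _ (by linarith [h.1])]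
  have hb : 0 < (1 - y₀) / (1 - x₀) :=
    div_pos (by linarith [h.2.1, h.2.2.2]) (by linarith [h.2.1])
  have := h.f0_mono hx
  rw [coord_of_ge (by linarith [h.2.2.1]), coord_of_ge (by linarith [h.1]), h.one_sub_f0 hx,
    mul_left_comm, Real.log_mul hb.ne' (by linarith)]
  ring

lemma log_affine_sub_le {a x y : ℝ} (ha : 0 < a) (ha' : a < 1) (hx : 0 ≤ x) (hxy : x ≤ y)
    (hy : y < 1) :
    Real.log (1 - a * x) - Real.log (1 - a * y) ≤
      a * (Real.log (1 - x) - Real.log (1 - y)) := by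
  have hX : 0 < 1 - x := by linarith
  have hY : 0 < 1 - y := by linarith
  have hax : 0 < 1 - a * x := by nlinarith
  have hay : 0 < 1 - a * y := by nlinarith
  have hc := strictConcaveOn_log_Ioi.concaveOn.2 (Set.mem_Ioi.2 (one_pos : (0 : ℝ) < 1))
    (Set.mem_Ioi.2 (div_pos hY hX)) (by linarith : 0 ≤ 1 - a) ha.le (by ring)
  simp only [smul_eq_mul, Real.log_one, mul_zero, zero_add, mul_one] at hc
  rw [Real.log_div hY.ne' hX.ne'] at hc
  have hpos : 0 < 1 - a + a * ((1 - y) / (1 - x)) := by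
    have := div_pos hY hX
    nlinarith
  have hmul : (1 - a * x) * (1 - a + a * ((1 - y) / (1 - x))) ≤ 1 - a * y := by
    have e : 1 - a * y - (1 - a * x) * (1 - a + a * ((1 - y) / (1 - x))) =
        a * (1 - a) * x * (y - x) / (1 - x) := by
      field_simp
      ring
    have : 0 ≤ a * (1 - a) * x * (y - x) / (1 - x) := by
      have : 0 ≤ y - x := by linarith
      have : 0 ≤ 1 - a := by linarith
      positivity
    linarith
  have hl := Real.log_le_log (mul_pos hax hpos) hmul
  rw [Real.log_mul hax.ne' hpos.ne'] at hl
  linarith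

lemma A1.coord_f0_sub_le (h : A1 x₀ y₀) {θ u x y : ℝ} (hu : 1 / 2 ≤ u) (hθ : y₀ / x₀ ≤ θ)
    (hθ' : (1 - u) / u ≤ θ) (hux : u ≤ x) (hxy : x ≤ y) (hy : y ≤ x₀) :
    coord (f0 x₀ y₀ y) - coord (f0 x₀ y₀ x) ≤ θ * (coord y - coord x) := by
  have ha := h.ratio_pos
  have ha' := h.ratio_lt_one
  have hx₀ : y₀ / x₀ * x₀ = y₀ := div_mul_cancel₀ _ (by linarith [h.1])
  obtain ⟨h1, h2, h3, h4⟩ := h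
  rw [f0_of_le hy, f0_of_le (hxy.trans hy)]
  set a := y₀ / x₀
  have low : ∀ {x y : ℝ}, u ≤ x → x ≤ y → y ≤ x₀ → a * y ≤ 1 / 2 →
      coord (a * y) - coord (a * x) ≤ θ * (coord y - coord x) := by
    intro x y hux hxy hy hay
    have hxp : 0 < x := by linarith
    have hyp : 0 < y := by linarith
    rw [coord_of_le hay, coord_of_le (by nlinarith), coord_of_ge (by linarith : 1 / 2 ≤ x),
      coord_of_ge (by linarith : 1 / 2 ≤ y), mul_left_comm, mul_left_comm 2 a x,
      Real.log_mul ha.ne' (by positivity), Real.log_mul ha.ne' (by positivity),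
      Real.log_mul two_ne_zero hyp.ne', Real.log_mul two_ne_zero hxp.ne',
      Real.log_mul two_ne_zero (by linarith), Real.log_mul two_ne_zero (by linarith)]
    have e1 := log_sub_log_le_sub_div hxp hxy
    have e2 := sub_div_le_log_sub_log (a := 1 - x) (b := 1 - y) (by linarith) (by linarith)
    have e3 : (1 - x) / x ≤ θ := by
      refine le_trans ?_ hθ'
      rw [div_le_div_iff₀ hxp (by linarith)]
      nlinarith
    have e4 : (y - x) / x = (1 - x) / x * ((1 - x - (1 - y)) / (1 - x)) := by
      have : 1 - x ≠ 0 := by linarith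
      field_simp
      ring
    have e5 : 0 ≤ (1 - x - (1 - y)) / (1 - x) := div_nonneg (by linarith) (by linarith)
    have e6 := mul_le_mul_of_nonneg_right e3 e5
    have e7 := mul_le_mul_of_nonneg_left e2 (ha.le.trans hθ)
    linarith
  have high : ∀ {x y : ℝ}, u ≤ x → x ≤ y → y ≤ x₀ → 1 / 2 ≤ a * x →
      coord (a * y) - coord (a * x) ≤ θ * (coord y - coord x) := by
    intro x y hux hxy hy hax
    have hay : 1 / 2 ≤ a * y := hax.trans (by gcongr)
    have hax1 : a * x < 1 := by nlinarith
    have hay1 : a * y < 1 := by nlinarith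
    rw [coord_of_ge hay, coord_of_ge hax, coord_of_ge (by linarith : 1 / 2 ≤ x),
      coord_of_ge (by linarith : 1 / 2 ≤ y),
      Real.log_mul two_ne_zero (by linarith), Real.log_mul two_ne_zero (by linarith),
      Real.log_mul two_ne_zero (by linarith), Real.log_mul two_ne_zero (by linarith)]
    have e1 := log_affine_sub_le ha ha' (by linarith : 0 ≤ x) hxy (by linarith)
    have e2 : 0 ≤ Real.log (1 - x) - Real.log (1 - y) :=
      sub_nonneg.2 (Real.log_le_log (by linarith) (by linarith))
    linarith [mul_le_mul_of_nonneg_right hθ e2]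
  rcases le_total (a * y) (1 / 2) with hay | hay
  · exact low hux hxy hy hay
  rcases le_total (1 / 2) (a * x) with hax | hax
  · exact high hux hxy hy hax
  have hz : a * (1 / 2 / a) = 1 / 2 := mul_div_cancel₀ _ ha.ne'
  have hxz : x ≤ 1 / 2 / a := by rw [le_div_iff₀ ha]; linarith
  have hzy : 1 / 2 / a ≤ y := by rw [div_le_iff₀ ha]; linarith
  have e1 := low hux hxz (hzy.trans hy) hz.le
  have e2 := high (hux.trans hxz) hzy hy hz.ge
  linarith

lemma A1.coord_f0_nonexpansive_of_le (h : A1 x₀ y₀) {x y : ℝ} (hx : 0 < x) (hxy : x ≤ y)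
    (hy : y < 1) :
    coord (f0 x₀ y₀ y) - coord (f0 x₀ y₀ x) ≤ coord y - coord x := by
  obtain ⟨h1, h2, h3, h4⟩ := id h
  have low : ∀ {x y : ℝ}, 0 < x → x ≤ y → y ≤ 1 / 2 →
      coord (f0 x₀ y₀ y) - coord (f0 x₀ y₀ x) ≤ coord y - coord x := by
    intro x y hx hxy hy
    rw [h.coord_f0_of_le_half hx (hxy.trans hy), h.coord_f0_of_le_half (hx.trans_le hxy) hy]
    linarith
  have mid : ∀ {x y : ℝ}, 1 / 2 ≤ x → x ≤ y → y ≤ x₀ →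
      coord (f0 x₀ y₀ y) - coord (f0 x₀ y₀ x) ≤ coord y - coord x := by
    intro x y hx hxy hy
    have := h.coord_f0_sub_le (θ := 1) le_rfl h.ratio_lt_one.le (by norm_num) hx hxy hy
    linarith
  have high : ∀ {x y : ℝ}, x₀ ≤ x → x ≤ y → y < 1 →
      coord (f0 x₀ y₀ y) - coord (f0 x₀ y₀ x) ≤ coord y - coord x := by
    intro x y hx hxy hy
    rw [h.coord_f0_of_ge hx (hxy.trans_lt hy), h.coord_f0_of_ge (hx.trans hxy) hy]
    linarith
  have midhigh : ∀ {x y : ℝ}, 1 / 2 ≤ x → x ≤ y → y < 1 →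
      coord (f0 x₀ y₀ y) - coord (f0 x₀ y₀ x) ≤ coord y - coord x := by
    intro x y hx hxy hy
    rcases le_total y x₀ with hyx | hyx
    · exact mid hx hxy hyx
    rcases le_total x₀ x with hxx | hxx
    · exact high hxx hxy hy
    have e1 := mid hx hxx le_rfl
    have e2 := high le_rfl hyx hy
    linarith
  rcases le_total y (1 / 2) with hyh | hyh
  · exact low hx hxy hyh
  rcases le_total (1 / 2) x with hxh | hxh
  · exact midhigh hxh hxy hy
  have e1 := low hx hxh le_rfl
  have e2 := midhigh le_rfl hyh hy
  linarith

lemma A1.coord_f0_mono (h : A1 x₀ y₀) {x y : ℝ} (hx : x ∈ Ioo (0 : ℝ) 1)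
    (hy : y ∈ Ioo (0 : ℝ) 1) (hxy : x ≤ y) : coord (f0 x₀ y₀ x) ≤ coord (f0 x₀ y₀ y) :=
  (coord_le_coord_iff (h.f0_mem hx) (h.f0_mem hy)).2 (h.f0_mono hxy)

lemma A1.coord_f0_nonexpansive (h : A1 x₀ y₀) {x y : ℝ} (hx : x ∈ Ioo (0 : ℝ) 1)
    (hy : y ∈ Ioo (0 : ℝ) 1) :
    |coord (f0 x₀ y₀ x) - coord (f0 x₀ y₀ y)| ≤ |coord x - coord y| := by
  rcases le_total x y with hxy | hxy
  · rw [abs_sub_comm, abs_sub_comm (coord x),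
      abs_of_nonneg (sub_nonneg.2 (h.coord_f0_mono hx hy hxy))]
    exact (h.coord_f0_nonexpansive_of_le hx.1 hxy hy.2).trans (le_abs_self _)
  · rw [abs_of_nonneg (sub_nonneg.2 (h.coord_f0_mono hy hx hxy))]
    exact (h.coord_f0_nonexpansive_of_le hy.1 hxy hx.2).trans (le_abs_self _)

lemma A1.coord_f1_nonexpansive (h : A1 x₀ y₀) {x y : ℝ} (hx : x ∈ Ioo (0 : ℝ) 1)
    (hy : y ∈ Ioo (0 : ℝ) 1) :
    |coord (f1 x₀ y₀ x) - coord (f1 x₀ y₀ y)| ≤ |coord x - coord y| := by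
  have := h.coord_f0_nonexpansive (one_sub_mem hx) (one_sub_mem hy)
  rwa [coord_one_sub, coord_one_sub, neg_sub_neg, abs_sub_comm, abs_sub_comm (coord y),
    ← neg_sub_neg, ← coord_f1, ← coord_f1] at this

lemma A1.coord_fb_nonexpansive (h : A1 x₀ y₀) (b : Bool) {x y : ℝ} (hx : x ∈ Ioo (0 : ℝ) 1)
    (hy : y ∈ Ioo (0 : ℝ) 1) :
    |coord (fb x₀ y₀ b x) - coord (fb x₀ y₀ b y)| ≤ |coord x - coord y| := by
  cases b
  · exact h.coord_f0_nonexpansive hx hy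
  · exact h.coord_f1_nonexpansive hx hy

/-- Uniform contraction of `f0`, in the logarithmic coordinate, on compact subsets of
`(1/2, x₀]`. -/
lemma A1.exists_contraction (h : A1 x₀ y₀) {t : ℝ} (ht : 0 < t) :
    ∃ θ : ℝ, 0 < θ ∧ θ < 1 ∧ ∀ x ∈ Ioo (0 : ℝ) 1, ∀ y ∈ Ioo (0 : ℝ) 1,
      coord x ∈ Icc t (coord x₀) → coord y ∈ Icc t (coord x₀) →
      |coord (f0 x₀ y₀ x) - coord (f0 x₀ y₀ y)| ≤ θ * |coord x - coord y| := by
  have hexp : Real.exp (-t) < 1 := by simpa using ht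
  have hexp0 := Real.exp_pos (-t)
  set u := 1 - Real.exp (-t) / 2 with hu
  have hu2 : 1 / 2 < u := by linarith
  have hum : u ∈ Ioo (0 : ℝ) 1 := ⟨by linarith, by linarith⟩
  have hcu : coord u = t := by
    rw [coord_of_ge hu2.le, show 2 * (1 - u) = Real.exp (-t) by rw [hu]; ring, Real.log_exp,
      neg_neg]
  refine ⟨max (y₀ / x₀) ((1 - u) / u), lt_max_of_lt_left h.ratio_pos,
    max_lt h.ratio_lt_one ((div_lt_one hum.1).2 (by linarith)), ?_⟩
  have key : ∀ x ∈ Ioo (0 : ℝ) 1, ∀ y ∈ Ioo (0 : ℝ) 1,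
      coord x ∈ Icc t (coord x₀) → coord y ∈ Icc t (coord x₀) → x ≤ y →
      |coord (f0 x₀ y₀ y) - coord (f0 x₀ y₀ x)| ≤
        max (y₀ / x₀) ((1 - u) / u) * |coord y - coord x| := by
    intro x hx y hy hcx hcy hxy
    have h1 : u ≤ x := (coord_le_coord_iff hum hx).1 (by rw [hcu]; exact hcx.1)
    have h2 : y ≤ x₀ := (coord_le_coord_iff hy h.mem_left).1 hcy.2
    rw [abs_of_nonneg (sub_nonneg.2 (h.coord_f0_mono hx hy hxy)),
      abs_of_nonneg (sub_nonneg.2 ((coord_le_coord_iff hx hy).2 hxy))]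
    exact h.coord_f0_sub_le hu2.le (le_max_left _ _) (le_max_right _ _) h1 hxy h2
  intro x hx y hy hcx hcy
  rcases le_total x y with hxy | hxy
  · rw [abs_sub_comm, abs_sub_comm (coord x)]
    exact key x hx y hy hcx hcy hxy
  · exact key y hy x hx hcy hcx hxy

end Dynamics

/-! ### A Lyapunov function -/

/-- Displacement `τ ↦ s` of the map `f0` in the logarithmic coordinate: translation by `-α` on
`(-∞, 0]`, by `-γ` on `[τ₀, ∞)`, and monotone and nonexpansive in between. -/
structure LeftStep (α γ τ₀ τ s : ℝ) : Prop where
  lower : τ - γ ≤ s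
  upper : s ≤ τ - α
  of_nonpos : τ ≤ 0 → s = τ - α
  of_ge : τ₀ ≤ τ → s = τ - γ
  le_of_le : τ ≤ τ₀ → s ≤ τ₀ - γ
  ge_of_nonneg : 0 ≤ τ → -α ≤ s

section Dynamics

variable {x₀ y₀ : ℝ}

lemma A1.leftStep (h : A1 x₀ y₀) {x : ℝ} (hx : x ∈ Ioo (0 : ℝ) 1) :
    LeftStep (-Real.log (y₀ / x₀)) (Real.log ((1 - y₀) / (1 - x₀))) (coord x₀)
      (coord x) (coord (f0 x₀ y₀ x)) := by
  have hhalf : (1 / 2 : ℝ) ∈ Ioo (0 : ℝ) 1 := by norm_num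
  have hx₀ := h.mem_left
  have h1 : ∀ {x : ℝ}, x ∈ Ioo (0 : ℝ) 1 → coord x ≤ 0 →
      coord (f0 x₀ y₀ x) = coord x - -Real.log (y₀ / x₀) := by
    intro x hx hc
    rw [← coord_half, coord_le_coord_iff hx hhalf] at hc
    rw [h.coord_f0_of_le_half hx.1 hc]; ring
  have h2 : ∀ {x : ℝ}, x ∈ Ioo (0 : ℝ) 1 → coord x₀ ≤ coord x →
      coord (f0 x₀ y₀ x) = coord x - Real.log ((1 - y₀) / (1 - x₀)) := by
    intro x hx hc
    rw [coord_le_coord_iff hx₀ hx] at hc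
    exact h.coord_f0_of_ge hc hx.2
  have e1 := h1 hhalf coord_half.le
  have e2 := h2 hx₀ le_rfl
  rw [coord_half] at e1
  have hmono : coord (1 / 2) ≤ coord x₀ := (coord_le_coord_iff hhalf hx₀).2 h.1.le
  rw [coord_half] at hmono
  have h3 := h.coord_f0_nonexpansive_of_le (x := 1 / 2) (y := x₀) (by norm_num) h.1.le hx₀.2
  rw [coord_half] at h3
  refine ⟨?_, ?_, h1 hx, h2 hx, ?_, ?_⟩
  · rcases le_total x x₀ with hc | hc
    · have := h.coord_f0_nonexpansive_of_le hx.1 hc hx₀.2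
      linarith
    · exact (h2 hx ((coord_le_coord_iff hx₀ hx).2 hc)).ge
  · rcases le_total x (1 / 2) with hc | hc
    · rw [← coord_le_coord_iff hx hhalf, coord_half] at hc
      exact (h1 hx hc).le
    · have := h.coord_f0_nonexpansive_of_le (by norm_num) hc hx.2
      rw [coord_half] at this
      linarith
  · intro hc
    rw [← e2]
    exact h.coord_f0_mono hx hx₀ ((coord_le_coord_iff hx hx₀).1 hc)
  · intro hc
    rw [← coord_half, coord_le_coord_iff hhalf hx] at hc
    have := h.coord_f0_mono hhalf hx hc
    linarith

lemma A1.rightStep (h : A1 x₀ y₀) {x : ℝ} (hx : x ∈ Ioo (0 : ℝ) 1) :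
    LeftStep (-Real.log (y₀ / x₀)) (Real.log ((1 - y₀) / (1 - x₀))) (coord x₀)
      (-coord x) (-coord (f1 x₀ y₀ x)) := by
  rw [coord_f1, neg_neg, ← coord_one_sub]
  exact h.leftStep (one_sub_mem hx)

lemma A1.neg_log_ratio_pos (h : A1 x₀ y₀) : 0 < -Real.log (y₀ / x₀) :=
  neg_pos.2 (Real.log_neg h.ratio_pos h.ratio_lt_one)

lemma A1.log_ratio_pos (h : A1 x₀ y₀) : 0 < Real.log ((1 - y₀) / (1 - x₀)) := by
  obtain ⟨h1, h2, h3, h4⟩ := h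
  exact Real.log_pos ((one_lt_div (by linarith)).2 (by linarith))

lemma A1.log_ratio_le (h : A1 x₀ y₀) : Real.log ((1 - y₀) / (1 - x₀)) ≤ coord x₀ := by
  obtain ⟨h1, h2, h3, h4⟩ := h
  rw [coord_of_ge h1.le, ← Real.log_inv]
  refine Real.log_le_log (div_pos (by linarith) (by linarith)) ?_
  have : 0 < 1 - x₀ := by linarith
  rw [mul_inv, ← div_eq_mul_inv]
  gcongr
  linarith

lemma A1.neg_log_ratio_lt (h : A1 x₀ y₀) : -Real.log (y₀ / x₀) < coord x₀ := by
  have ha := h.ratio_pos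
  obtain ⟨h1, h2, h3, h4⟩ := h
  rw [coord_of_ge h1.le]
  refine neg_lt_neg (Real.log_lt_log (by linarith) ?_)
  rw [lt_div_iff₀ (by linarith)]
  nlinarith [sq_nonneg (2 * x₀ - 1)]

end Dynamics

/-- A bounded function on the line that doubles in mean under the random dynamics outside the two
zones of uniform contraction. -/
lemma exists_weight {α γ τ₀ p : ℝ} (hα : 0 < α) (hατ : α < τ₀) (hγ : 0 < γ) (hγτ : γ ≤ τ₀)
    (hp : 0 < p) :
    ∃ (W : ℝ → ℝ) (t r B M : ℝ), 0 < t ∧ 0 < r ∧ r ≤ t / 2 ∧ 0 ≤ B ∧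
      (∀ τ, Real.exp (-(B * |τ|)) ≤ W τ) ∧ (∀ τ, W τ ≤ M) ∧
      ∀ τ s₀ s₁ p₀ p₁ : ℝ, LeftStep α γ τ₀ τ s₀ → LeftStep α γ τ₀ (-τ) (-s₁) → p ≤ p₀ → p ≤ p₁ →
        2 * W τ ≤ p₀ * W s₀ + p₁ * W s₁ ∨ τ ∈ Icc t (τ₀ - r) ∨ -τ ∈ Icc t (τ₀ - r) := by
  obtain ⟨q, hq, hq1, hq2, hq3⟩ : ∃ q, 0 < q ∧ q ≤ γ / 2 ∧ q ≤ α ∧ q ≤ τ₀ / 2 :=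
    ⟨min (γ / 2) (min α (τ₀ / 2)), lt_min (by linarith) (lt_min hα (by linarith)),
      min_le_left _ _, (min_le_right _ _).trans (min_le_left _ _),
      (min_le_right _ _).trans (min_le_right _ _)⟩
  set t := (τ₀ - α) / 2 with ht
  have htpos : 0 < t := by linarith
  obtain ⟨r, hr, hr1, hr2, hr3⟩ : ∃ r, 0 < r ∧ r ≤ t / 2 ∧ r ≤ γ / 2 ∧ r ≤ τ₀ / 4 :=
    ⟨min (t / 2) (min (γ / 2) (τ₀ / 4)),
      lt_min (by linarith) (lt_min (by linarith) (by linarith)),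
      min_le_left _ _, (min_le_right _ _).trans (min_le_left _ _),
      (min_le_right _ _).trans (min_le_right _ _)⟩
  obtain ⟨B, hB, hBq⟩ : ∃ B, 0 < B ∧ 2 / p ≤ Real.exp (B * q) := by
    refine ⟨2 / p / q, by positivity, ?_⟩
    rw [div_mul_cancel₀ _ hq.ne']
    linarith [Real.add_one_le_exp (2 / p)]
  have gain : ∀ a b : ℝ, a + q ≤ b → 2 * Real.exp (B * a) ≤ p * Real.exp (B * b) := by
    intro a b hab
    have h1 : Real.exp (B * a) * Real.exp (B * q) ≤ Real.exp (B * b) := by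
      rw [← Real.exp_add]
      exact Real.exp_le_exp.2 (by nlinarith)
    rw [div_le_iff₀ hp] at hBq
    have h2 := Real.exp_pos (B * a)
    nlinarith
  set W : ℝ → ℝ := fun τ => Real.exp (B * if τ ≤ α + t then τ else -τ) with hW
  have hWpos : ∀ τ, 0 < W τ := fun τ => Real.exp_pos _
  have hWl : ∀ τ, τ ≤ α + t → W τ = Real.exp (B * τ) := fun τ h => by simp only [hW, if_pos h]
  have hWr : ∀ τ, α + t < τ → W τ = Real.exp (B * -τ) :=
    fun τ h => by simp only [hW, if_neg h.not_ge]
  refine ⟨W, t, r, B, Real.exp (B * (α + t)), htpos, hr, hr1, hB.le, ?_, ?_, ?_⟩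
  · intro τ
    refine Real.exp_le_exp.2 ?_
    rw [← mul_neg]
    refine mul_le_mul_of_nonneg_left ?_ hB.le
    split_ifs
    · exact neg_abs_le τ
    · exact neg_le_neg (le_abs_self τ)
  · intro τ
    refine Real.exp_le_exp.2 (mul_le_mul_of_nonneg_left ?_ hB.le)
    split_ifs with h
    · exact h
    · linarith
  intro τ s₀ s₁ p₀ p₁ h₀ h₁ hp₀ hp₁
  have use₀ : 2 * W τ ≤ p * W s₀ → 2 * W τ ≤ p₀ * W s₀ + p₁ * W s₁ := by
    intro h
    nlinarith [hWpos s₀, hWpos s₁]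
  have use₁ : 2 * W τ ≤ p * W s₁ → 2 * W τ ≤ p₀ * W s₀ + p₁ * W s₁ := by
    intro h
    nlinarith [hWpos s₀, hWpos s₁]
  by_cases c1 : τ < -(τ₀ - r)
  · left
    refine use₁ ?_
    have b1 := h₁.ge_of_nonneg (by linarith)
    have b2 : τ + γ - r ≤ s₁ := by
      rcases le_total τ₀ (-τ) with h | h
      · linarith [h₁.of_ge h]
      · linarith [h₁.le_of_le h]
    rw [hWl τ (by linarith), hWl s₁ (by linarith)]
    exact gain _ _ (by linarith)
  by_cases c2 : τ ≤ -t
  · right; right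
    exact ⟨by linarith, by linarith⟩
  by_cases c3 : τ < t
  · left
    refine use₁ ?_
    have b1 := h₁.upper
    have b2 : s₁ ≤ α + t := by
      rcases le_total 0 τ with h | h
      · linarith [h₁.of_nonpos (by linarith)]
      · linarith [h₁.ge_of_nonneg (by linarith)]
    rw [hWl τ (by linarith), hWl s₁ b2]
    exact gain _ _ (by linarith)
  by_cases c4 : τ ≤ τ₀ - r
  · right; left
    exact ⟨by linarith, c4⟩
  left
  refine use₀ ?_
  have b1 := h₀.lower
  have b2 : s₀ ≤ τ - γ + r := by
    rcases le_total τ τ₀ with h | h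
    · linarith [h₀.le_of_le h]
    · linarith [h₀.of_ge h]
  rw [hWr τ (by linarith)]
  rcases le_or_gt s₀ (α + t) with h | h
  · rw [hWl s₀ h]
    exact gain _ _ (by linarith)
  · rw [hWr s₀ h]
    exact gain _ _ (by linarith)

/-- A positive Lyapunov exponent at an end point yields an exponential moment that contracts. -/
lemma exists_exp_moment {α γ a : ℝ} (ha : 0 < -(a * α) + (1 - a) * γ) :
    ∀ᶠ δ in 𝓝[>] (0 : ℝ), a * Real.exp (δ * α) + (1 - a) * Real.exp (-(δ * γ)) < 1 := by
  set g : ℝ → ℝ := fun δ => a * Real.exp (δ * α) + (1 - a) * Real.exp (-(δ * γ)) with hg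
  have hd : HasDerivAt g (a * α - (1 - a) * γ) 0 := by
    have h1 : HasDerivAt (fun δ : ℝ => Real.exp (δ * α)) (Real.exp (0 * α) * (1 * α)) 0 :=
      ((hasDerivAt_id (0 : ℝ)).mul_const α).exp
    have h2 : HasDerivAt (fun δ : ℝ => Real.exp (-(δ * γ))) (Real.exp (-(0 * γ)) * -(1 * γ)) 0 :=
      ((hasDerivAt_id (0 : ℝ)).mul_const γ).neg.exp
    exact ((h1.const_mul a).fun_add (h2.const_mul (1 - a))).congr_deriv (by simp; ring)
  have hs := (hasDerivAt_iff_tendsto_slope.1 hd).mono_left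
    (nhdsWithin_mono (0 : ℝ) (fun x (hx : 0 < x) => hx.ne'))
  filter_upwards [hs.eventually_lt_const (by linarith : a * α - (1 - a) * γ < 0),
    self_mem_nhdsWithin] with δ hδ hpos
  have hpos : 0 < δ := hpos
  have g0 : g 0 = 1 := by simp [hg]
  rw [slope_def_field, g0, sub_zero, div_lt_iff₀ hpos, zero_mul] at hδ
  linarith

/-- Tail estimate for the exponential moment. -/
lemma exp_moment_of_le_neg {α γ τ₀ δ κ T τ s₀ s₁ p₀ p₁ : ℝ} (hα : 0 < α) (hγ : 0 < γ)
    (hγT : γ ≤ T) (hT : τ₀ ≤ T) (hτ : τ ≤ -T)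
    (h₀ : LeftStep α γ τ₀ τ s₀) (h₁ : LeftStep α γ τ₀ (-τ) (-s₁))
    (hp : p₀ * Real.exp (δ * α) + p₁ * Real.exp (-(δ * γ)) ≤ 1 - κ) :
    p₀ * Real.exp (δ * |s₀|) + p₁ * Real.exp (δ * |s₁|) ≤ (1 - κ) * Real.exp (δ * |τ|) := by
  have e₀ := h₀.of_nonpos (by linarith)
  have e₁ := h₁.of_ge (by linarith)
  rw [abs_of_nonpos (by linarith : τ ≤ 0), abs_of_nonpos (by linarith : s₀ ≤ 0),
    abs_of_nonpos (by linarith : s₁ ≤ 0), show δ * -s₀ = δ * α + δ * -τ by rw [e₀]; ring,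
    show δ * -s₁ = -(δ * γ) + δ * -τ by rw [e₁]; ring, Real.exp_add, Real.exp_add]
  nlinarith [Real.exp_pos (δ * -τ)]

/-- Combining the exponential moment and the bounded weight into a Lyapunov function. -/
lemma exists_lyapunov_aux {α γ τ₀ δ κ T θ p : ℝ} {W : ℝ → ℝ} {t r B M : ℝ}
    (hα : 0 < α) (hγ : 0 < γ) (hδ : 0 < δ)
    (hκ : 0 < κ) (hκ1 : κ < 1) (hT : τ₀ ≤ T) (hT0 : 0 ≤ T) (hθ : 0 < θ) (hθ1 : θ < 1)
    (hp : 0 < p) (hp1 : p ≤ 1) (ht : 0 < t) (hr : 0 < r)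
    (hWl : ∀ τ, Real.exp (-(B * |τ|)) ≤ W τ) (hWM : ∀ τ, W τ ≤ M) (hB : 0 ≤ B) :
    ∃ (V : ℝ → ℝ) (L : ℝ), 0 < L ∧ L < 1 ∧ (∀ τ, 1 / 2 ≤ V τ) ∧
      ∀ τ s₀ s₁ p₀ p₁ d d₀ d₁ : ℝ, LeftStep α γ τ₀ τ s₀ → LeftStep α γ τ₀ (-τ) (-s₁) →
        p ≤ p₀ → p ≤ p₁ → p₀ + p₁ = 1 → 0 ≤ d₀ → 0 ≤ d₁ → d₀ ≤ d → d₁ ≤ d →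
        (T ≤ |τ| → p₀ * Real.exp (δ * |s₀|) + p₁ * Real.exp (δ * |s₁|) ≤
          (1 - κ) * Real.exp (δ * |τ|)) →
        (2 * W τ ≤ p₀ * W s₀ + p₁ * W s₁ ∨ (τ ∈ Icc t (τ₀ - r) ∧ d₀ ≤ θ * d) ∨
          (-τ ∈ Icc t (τ₀ - r) ∧ d₁ ≤ θ * d)) →
        p₀ * (V s₀ * d₀) + p₁ * (V s₁ * d₁) ≤ L * (V τ * d) := by
  have hWpos : ∀ τ, 0 < W τ := fun τ => (Real.exp_pos _).trans_le (hWl τ)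
  have hM : 0 < M := (hWpos 0).trans_le (hWM 0)
  set k := p * (1 - θ) with hk
  have hkpos : 0 < k := mul_pos hp (by linarith)
  have hk1 : k < 1 := by nlinarith
  set σ := k / (4 * M) with hσ
  have hσpos : 0 < σ := by positivity
  have hσM : σ * M = k / 4 := by rw [hσ]; field_simp
  have hσW : ∀ τ, σ * W τ ≤ k / 4 := fun τ => by
    rw [← hσM]; exact mul_le_mul_of_nonneg_left (hWM τ) hσpos.le
  set w := σ * Real.exp (-(B * T)) with hw
  have hwpos : 0 < w := mul_pos hσpos (Real.exp_pos _)
  set G := Real.exp (δ * (γ + T)) with hG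
  have hG1 : 1 ≤ G := Real.one_le_exp (by positivity)
  have hE1 : ∀ τ : ℝ, 1 ≤ Real.exp (δ * |τ|) := fun τ => Real.one_le_exp (by positivity)
  obtain ⟨η, hη, hη1, hη2, hη3⟩ : ∃ η, 0 < η ∧ η * G ≤ 1 ∧ η * G ≤ w / 2 ∧ η * G ≤ k / 4 := by
    have hGp : 0 < G := by linarith
    refine ⟨min 1 (min (w / 2) (k / 4)) / G,
      div_pos (lt_min one_pos (lt_min (by linarith) (by linarith))) hGp, ?_, ?_, ?_⟩ <;>
      rw [div_mul_cancel₀ _ hGp.ne']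
    · exact min_le_left _ _
    · exact (min_le_right _ _).trans (min_le_left _ _)
    · exact (min_le_right _ _).trans (min_le_right _ _)
  have hη1' : η ≤ 1 := by nlinarith
  set V : ℝ → ℝ := fun τ => 1 + η * Real.exp (δ * |τ|) - σ * W τ with hV
  have hVlow : ∀ τ, 1 - k / 4 ≤ V τ := by
    intro τ
    have h1 := hσW τ
    have h2 : 0 ≤ η * Real.exp (δ * |τ|) := by positivity
    simp only [hV]; linarith
  have hVup : ∀ τ, V τ ≤ 1 + η * Real.exp (δ * |τ|) := by
    intro τ
    have := mul_pos hσpos (hWpos τ)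
    simp only [hV]; linarith
  obtain ⟨l, hl, hl1, hl2, hl3, hl4⟩ :
      ∃ l, 0 < l ∧ l < 1 ∧ l ≤ η * κ / 2 ∧ l ≤ w / 4 ∧ l ≤ k / 2 :=
    ⟨min (1 / 2) (min (η * κ / 2) (min (w / 4) (k / 2))),
      lt_min (by norm_num) (lt_min (by positivity) (lt_min (by linarith) (by linarith))),
      (min_le_left _ _).trans_lt (by norm_num),
      (min_le_right _ _).trans (min_le_left _ _),
      (min_le_right _ _).trans ((min_le_right _ _).trans (min_le_left _ _)),
      (min_le_right _ _).trans ((min_le_right _ _).trans (min_le_right _ _))⟩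
  refine ⟨V, 1 - l, by linarith, by linarith, fun τ => by linarith [hVlow τ], ?_⟩
  intro τ s₀ s₁ p₀ p₁ d d₀ d₁ h₀ h₁ hp₀ hp₁ hsum hd₀ hd₁ hd₀d hd₁d hfar hzone
  have hd : 0 ≤ d := hd₀.trans hd₀d
  have hVpos : ∀ τ, 0 < V τ := fun τ => by linarith [hVlow τ]
  have hp₀pos : 0 < p₀ := hp.trans_le hp₀
  have hp₁pos : 0 < p₁ := hp.trans_le hp₁
  have hs : ∀ {s : ℝ}, |s| ≤ γ + |τ| → |τ| ≤ T → η * Real.exp (δ * |s|) ≤ η * G := by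
    intro s h1 h2
    refine mul_le_mul_of_nonneg_left (Real.exp_le_exp.2 ?_) hη.le
    exact mul_le_mul_of_nonneg_left (by linarith) hδ.le
  have hs₀ : |s₀| ≤ γ + |τ| := by
    have h2 := h₀.lower
    have h3 := h₀.upper
    have h4 := neg_abs_le τ
    have h5 := le_abs_self τ
    exact abs_le.2 ⟨by linarith, by linarith⟩
  have hs₁ : |s₁| ≤ γ + |τ| := by
    have h2 := h₁.lower
    have h3 := h₁.upper
    have h4 := neg_abs_le τ
    have h5 := le_abs_self τ
    exact abs_le.2 ⟨by linarith, by linarith⟩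
  have mix : ∀ {a b : ℝ}, a ≤ η * G → b ≤ η * G → p₀ * a + p₁ * b ≤ η * G := by
    intro a b ha hb
    have h1 := mul_le_mul_of_nonneg_left ha hp₀pos.le
    have h2 := mul_le_mul_of_nonneg_left hb hp₁pos.le
    have h3 : (p₀ + p₁) * (η * G) = η * G := by rw [hsum, one_mul]
    linarith
  have zone : ∀ {c₀ c₁ : ℝ}, |τ| ≤ T → 0 ≤ c₀ → 0 ≤ c₁ → p₀ * c₀ + p₁ * c₁ ≤ 1 - k →
      d₀ ≤ c₀ * d → d₁ ≤ c₁ * d →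
      p₀ * (V s₀ * d₀) + p₁ * (V s₁ * d₁) ≤ (1 - l) * (V τ * d) := by
    intro c₀ c₁ hτ hc₀ hc₁ hc h1 h2
    have v₀ : V s₀ ≤ 1 + η * G := (hVup s₀).trans (by linarith [hs hs₀ hτ])
    have v₁ : V s₁ ≤ 1 + η * G := (hVup s₁).trans (by linarith [hs hs₁ hτ])
    have hA : 0 ≤ 1 + η * G := by positivity
    calc p₀ * (V s₀ * d₀) + p₁ * (V s₁ * d₁)
        ≤ p₀ * ((1 + η * G) * (c₀ * d)) + p₁ * ((1 + η * G) * (c₁ * d)) := by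
          have := (hVpos s₀).le
          have := (hVpos s₁).le
          gcongr
      _ = (p₀ * c₀ + p₁ * c₁) * ((1 + η * G) * d) := by ring
      _ ≤ (1 - k) * ((1 + η * G) * d) := by gcongr
      _ ≤ (1 - k) * ((1 + k / 4) * d) := by
          have : 0 ≤ 1 - k := by linarith
          gcongr
      _ ≤ (1 - k / 2) * ((1 - k / 4) * d) := by linarith [mul_nonneg (sq_nonneg k) hd]
      _ ≤ (1 - l) * (V τ * d) := by
          have h3 := hVlow τ
          have : 0 ≤ 1 - k / 4 := by linarith
          have : 0 ≤ 1 - l := by linarith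
          gcongr
  rcases hzone with hW | ⟨⟨hz1, hz2⟩, hdd⟩ | ⟨⟨hz1, hz2⟩, hdd⟩
  · suffices p₀ * V s₀ + p₁ * V s₁ ≤ (1 - l) * V τ by
      calc p₀ * (V s₀ * d₀) + p₁ * (V s₁ * d₁) ≤ p₀ * (V s₀ * d) + p₁ * (V s₁ * d) := by
            have := (hVpos s₀).le
            have := (hVpos s₁).le
            gcongr
        _ = (p₀ * V s₀ + p₁ * V s₁) * d := by ring
        _ ≤ (1 - l) * V τ * d := by gcongr
        _ = _ := by ring
    have hσ2 := mul_le_mul_of_nonneg_left hW hσpos.le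
    have expand : p₀ * V s₀ + p₁ * V s₁ = 1 + (p₀ * (η * Real.exp (δ * |s₀|)) +
        p₁ * (η * Real.exp (δ * |s₁|))) - σ * (p₀ * W s₀ + p₁ * W s₁) := by
      simp only [hV]
      linear_combination hsum
    have hup := hVup τ
    have hVτ : V τ = 1 + η * Real.exp (δ * |τ|) - σ * W τ := rfl
    have hσWτ := mul_pos hσpos (hWpos τ)
    rcases le_total T |τ| with hτ | hτ
    · have h1 := mul_le_mul_of_nonneg_left (hfar hτ) hη.le
      have h2 := hE1 τ
      have h3 : l * V τ ≤ η * κ / 2 * (2 * Real.exp (δ * |τ|)) := by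
        have h4 : V τ ≤ 2 * Real.exp (δ * |τ|) := by
          linarith [mul_le_mul_of_nonneg_right hη1' (zero_le_one.trans h2)]
        have := (hVpos τ).le
        gcongr
      linarith
    · have h1 := mix (hs hs₀ hτ) (hs hs₁ hτ)
      have h2 : η * Real.exp (δ * |τ|) ≤ η * G := hs (by linarith) hτ
      have h3 : w ≤ σ * W τ := by
        refine mul_le_mul_of_nonneg_left (le_trans (Real.exp_le_exp.2 ?_) (hWl τ)) hσpos.le
        exact neg_le_neg (mul_le_mul_of_nonneg_left hτ hB)
      have h4 : l * V τ ≤ w / 4 * 2 := by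
        have : V τ ≤ 2 := by linarith
        have := (hVpos τ).le
        gcongr
      linarith [mul_pos hη (Real.exp_pos (δ * |τ|))]
  · refine zone (c₀ := θ) (c₁ := 1) ?_ hθ.le zero_le_one ?_ hdd (by linarith)
    · rw [abs_of_nonneg (by linarith)]; linarith
    · linarith [mul_le_mul_of_nonneg_right hp₀ (sub_nonneg.2 hθ1.le)]
  · refine zone (c₀ := 1) (c₁ := θ) ?_ zero_le_one hθ.le ?_ (by linarith) hdd
    · rw [abs_of_nonpos (by linarith)]; linarith
    · linarith [mul_le_mul_of_nonneg_right hp₁ (sub_nonneg.2 hθ1.le)]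

lemma exists_tail_bound {q₀ q₁ : ℝ → ℝ} (h₀ : ContinuousOn q₀ (Icc 0 1))
    (h₁ : ContinuousOn q₁ (Icc 0 1)) {A B C : ℝ} (h : q₀ 0 * A + q₁ 0 * B < C) :
    ∃ T : ℝ, ∀ x ∈ Ioo (0 : ℝ) 1, coord x ≤ -T → q₀ x * A + q₁ x * B ≤ C := by
  have hc : ContinuousWithinAt (fun x => q₀ x * A + q₁ x * B) (Icc 0 1) 0 :=
    ((h₀.mul_const A).add (h₁.mul_const B)) 0 (by simp)
  obtain ⟨ε, hε, hball⟩ := Metric.mem_nhdsWithin_iff.1 (hc.eventually_lt_const h)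
  refine ⟨max 0 (-Real.log ε), fun x hx hxT => ?_⟩
  suffices hm : x ∈ Metric.ball 0 ε from le_of_lt (hball ⟨hm, hx.1.le, hx.2.le⟩)
  have hT0 := le_max_left 0 (-Real.log ε)
  have hT1 := le_max_right 0 (-Real.log ε)
  have hhalf : x ≤ 1 / 2 := by
    rw [← coord_le_coord_iff hx (by norm_num), coord_half]; linarith
  rw [coord_of_le hhalf] at hxT
  have h2 := (Real.log_le_log_iff (by linarith [hx.1]) hε).1
    (by linarith : Real.log (2 * x) ≤ Real.log ε)
  rw [mem_ball_zero_iff, Real.norm_of_nonneg hx.1.le]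
  linarith [hx.1]

section System

variable {x₀ y₀ : ℝ} {p₀ p₁ : ℝ → ℝ}

lemma A3.exists_lower_bound (h : A3 p₀ p₁) :
    ∃ p : ℝ, 0 < p ∧ p ≤ 1 ∧ ∀ x ∈ Icc (0 : ℝ) 1, p ≤ p₀ x ∧ p ≤ p₁ x := by
  have hne : (Icc (0 : ℝ) 1).Nonempty := ⟨0, by simp⟩
  obtain ⟨u, hu, hmin⟩ := isCompact_Icc.exists_isMinOn hne h.1
  obtain ⟨v, hv, hmin'⟩ := isCompact_Icc.exists_isMinOn hne h.2.1
  obtain ⟨-, hu1, hu2, -, -⟩ := h.2.2 u hu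
  obtain ⟨-, -, -, hv1, -⟩ := h.2.2 v hv
  exact ⟨min (p₀ u) (p₁ v), lt_min hu1 hv1, (min_le_left _ _).trans hu2.le,
    fun x hx => ⟨(min_le_left _ _).trans (hmin hx), (min_le_right _ _).trans (hmin' hx)⟩⟩

/-- Average contraction of short distances, weighted by a Lyapunov function. -/
theorem exists_lyapunov (hA1 : A1 x₀ y₀) (hA3 : A3 p₀ p₁) (hA4 : A4 x₀ y₀ p₀ p₁) :
    ∃ (V : ℝ → ℝ) (L r : ℝ), 0 < L ∧ L < 1 ∧ 0 < r ∧ (∀ x, 1 / 2 ≤ V x) ∧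
      ∀ x ∈ Ioo (0 : ℝ) 1, ∀ y ∈ Ioo (0 : ℝ) 1, |coord x - coord y| ≤ r →
        p₀ x * (V (f0 x₀ y₀ x) * |coord (f0 x₀ y₀ x) - coord (f0 x₀ y₀ y)|) +
          p₁ x * (V (f1 x₀ y₀ x) * |coord (f1 x₀ y₀ x) - coord (f1 x₀ y₀ y)|) ≤
        L * (V x * |coord x - coord y|) := by
  obtain ⟨p, hp, hp1, hpp⟩ := hA3.exists_lower_bound
  have hα := hA1.neg_log_ratio_pos
  have hγ := hA1.log_ratio_pos
  obtain ⟨W, t, r, B, M, ht, hr, hrt, hB, hWl, hWM, hW⟩ :=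
    exists_weight hα hA1.neg_log_ratio_lt hγ hA1.log_ratio_le hp
  obtain ⟨θ, hθ, hθ1, hcontr⟩ := hA1.exists_contraction (half_pos ht)
  set α := -Real.log (y₀ / x₀) with hαdef
  set γ := Real.log ((1 - y₀) / (1 - x₀)) with hγdef
  have hlog : Real.log (y₀ / x₀) = -α := (neg_neg _).symm
  obtain ⟨δ, ⟨hδ0, hδ1⟩, hδ⟩ : ∃ δ, (p₀ 0 * Real.exp (δ * α) + p₁ 0 * Real.exp (-(δ * γ)) < 1 ∧
      p₁ 1 * Real.exp (δ * α) + p₀ 1 * Real.exp (-(δ * γ)) < 1) ∧ 0 < δ := by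
    have e0 := (hA3.2.2 0 (by simp)).1
    have e1 := (hA3.2.2 1 (by simp)).1
    obtain ⟨h0, h1⟩ := hA4
    rw [hlog] at h0 h1
    have q0 := exists_exp_moment (α := α) (γ := γ) (a := p₀ 0)
      (by rw [show 1 - p₀ 0 = p₁ 0 by linarith]; linarith)
    have q1 := exists_exp_moment (α := α) (γ := γ) (a := p₁ 1)
      (by rw [show 1 - p₁ 1 = p₀ 1 by linarith]; linarith)
    rw [show 1 - p₀ 0 = p₁ 0 by linarith] at q0
    rw [show 1 - p₁ 1 = p₀ 1 by linarith] at q1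
    exact ((q0.and q1).and self_mem_nhdsWithin).exists
  obtain ⟨κ, hκ, hκ1, hκ2, hκ3⟩ : ∃ κ : ℝ, 0 < κ ∧ κ < 1 ∧
      p₀ 0 * Real.exp (δ * α) + p₁ 0 * Real.exp (-(δ * γ)) < 1 - κ ∧
      p₁ 1 * Real.exp (δ * α) + p₀ 1 * Real.exp (-(δ * γ)) < 1 - κ := by
    obtain ⟨v, hv1, hv2⟩ := exists_between (max_lt (max_lt hδ0 hδ1) one_pos)
    rw [max_lt_iff, max_lt_iff] at hv1
    exact ⟨1 - v, by linarith, by linarith [hv1.2], by linarith [hv1.1.1], by linarith [hv1.1.2]⟩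
  obtain ⟨T₁, hT₁⟩ := exists_tail_bound hA3.1 hA3.2.1 hκ2
  have hflip : MapsTo (fun x : ℝ => 1 - x) (Icc 0 1) (Icc 0 1) :=
    fun x hx => ⟨by linarith [hx.2], by linarith [hx.1]⟩
  obtain ⟨T₂, hT₂⟩ := exists_tail_bound (q₀ := fun x => p₁ (1 - x)) (q₁ := fun x => p₀ (1 - x))
    (hA3.2.1.comp (by fun_prop) hflip) (hA3.1.comp (by fun_prop) hflip) (by simpa using hκ3)
  obtain ⟨T, hTτ, hTγ, hTT₁, hTT₂⟩ : ∃ T, coord x₀ ≤ T ∧ γ ≤ T ∧ T₁ ≤ T ∧ T₂ ≤ T :=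
    ⟨max (max (coord x₀) γ) (max T₁ T₂), (le_max_left _ _).trans (le_max_left _ _),
      (le_max_right _ _).trans (le_max_left _ _), (le_max_left _ _).trans (le_max_right _ _),
      (le_max_right _ _).trans (le_max_right _ _)⟩
  obtain ⟨V, L, hL, hL1, hV, hmain⟩ := exists_lyapunov_aux (W := W) (τ₀ := coord x₀) (T := T)
    hα hγ hδ hκ hκ1 hTτ (by linarith) hθ hθ1 hp hp1 ht hr hWl hWM hB
  refine ⟨fun x => V (coord x), L, r, hL, hL1, hr, fun x => hV _, ?_⟩
  intro x hx y hy hxy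
  have hx' : x ∈ Icc (0 : ℝ) 1 := Ioo_subset_Icc_self hx
  have s₀ := hA1.leftStep hx
  have s₁ := hA1.rightStep hx
  obtain ⟨hq₀, hq₁⟩ := hpp x hx'
  refine hmain (coord x) _ _ _ _ _ _ _ s₀ s₁ hq₀ hq₁ (hA3.2.2 x hx').1 (abs_nonneg _)
    (abs_nonneg _) (hA1.coord_f0_nonexpansive hx hy) (hA1.coord_f1_nonexpansive hx hy) ?_ ?_
  · intro hT
    rcases le_abs'.1 hT with h | h
    · exact exp_moment_of_le_neg hα hγ hTγ hTτ h s₀ s₁ (hT₁ x hx (by linarith))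
    · have h2 := hT₂ (1 - x) (one_sub_mem hx) (by rw [coord_one_sub]; linarith)
      rw [sub_sub_cancel] at h2
      have h3 := exp_moment_of_le_neg (s₁ := -coord (f0 x₀ y₀ x)) hα hγ hTγ hTτ (neg_le_neg h) s₁
        (by rw [neg_neg, neg_neg]; exact s₀) h2
      rwa [abs_neg, abs_neg, abs_neg, add_comm] at h3
  · rcases hW _ _ _ _ _ s₀ s₁ hq₀ hq₁ with h | h | h
    · exact Or.inl h
    · refine Or.inr (Or.inl ⟨h, hcontr x hx y hy ?_ ?_⟩)
      · exact ⟨by linarith [h.1], by linarith [h.2]⟩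
      · obtain ⟨h1, h2⟩ := abs_le.1 hxy
        exact ⟨by linarith [h.1], by linarith [h.2]⟩
    · refine Or.inr (Or.inr ⟨h, ?_⟩)
      have h3 := hcontr (1 - x) (one_sub_mem hx) (1 - y) (one_sub_mem hy)
      rw [coord_one_sub, coord_one_sub] at h3
      obtain ⟨h1, h2⟩ := abs_le.1 hxy
      have h4 := h3 ⟨by linarith [h.1], by linarith [h.2]⟩ ⟨by linarith [h.1], by linarith [h.2]⟩
      rwa [neg_sub_neg, abs_sub_comm, abs_sub_comm (coord y), ← neg_sub_neg, ← coord_f1,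
        ← coord_f1] at h4

end System

/-! ### Words and cylinders -/

/-- The point reached from `x` along a word: `f_{i_k} ∘ ⋯ ∘ f_{i_1} (x)`. -/
noncomputable def run (x₀ y₀ : ℝ) : ℝ → List Bool → ℝ
  | x, [] => x
  | x, b :: w => run x₀ y₀ (fb x₀ y₀ b x) w

/-- All words of length `n`. -/
def words : ℕ → Finset (List Bool)
  | 0 => {[]}
  | n + 1 => (words n).map ⟨List.cons false, List.cons_injective⟩ ∪
      (words n).map ⟨List.cons true, List.cons_injective⟩

/-- The first `n` terms of a sequence. -/
def pre (ω : ℕ → Bool) (n : ℕ) : List Bool := (List.range n).map ω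

lemma mem_words {n : ℕ} {w : List Bool} : w ∈ words n ↔ w.length = n := by
  induction n generalizing w with
  | zero => simp [words]
  | succ n ih =>
    cases w with
    | nil => simp [words]
    | cons b w => cases b <;> simp [words, ih]

lemma sum_words_succ (n : ℕ) (g : List Bool → ℝ) :
    ∑ w ∈ words (n + 1), g w = ∑ w ∈ words n, g (false :: w) + ∑ w ∈ words n, g (true :: w) := by
  rw [words, Finset.sum_union, Finset.sum_map, Finset.sum_map]
  · rfl
  · rw [Finset.disjoint_left]
    intro w hw hw'
    simp only [Finset.mem_map, Function.Embedding.coeFn_mk] at hw hw'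
    obtain ⟨u, -, rfl⟩ := hw
    obtain ⟨v, -, hv⟩ := hw'
    simp at hv

lemma pre_succ (ω : ℕ → Bool) (n : ℕ) : pre ω (n + 1) = pre ω n ++ [ω n] := by
  simp [pre, List.range_succ]

lemma length_pre (ω : ℕ → Bool) (n : ℕ) : (pre ω n).length = n := by simp [pre]

lemma mem_cyl_iff {ω : ℕ → Bool} {w : List Bool} : ω ∈ cyl w ↔ pre ω w.length = w := by
  constructor
  · intro h
    refine List.ext_getElem (length_pre ω _) fun i h1 h2 => ?_
    simpa [pre] using h ⟨i, h2⟩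
  · intro h j
    have := List.getElem_of_eq h (i := j) (by rw [length_pre]; exact j.2)
    simpa [pre] using this

lemma mem_cyl_pre (ω : ℕ → Bool) (n : ℕ) : ω ∈ cyl (pre ω n) := by
  rw [mem_cyl_iff, length_pre]

lemma measurableSet_cyl (w : List Bool) : MeasurableSet (cyl w) := by
  have : cyl w = ⋂ j : Fin w.length, {ω : ℕ → Bool | ω j = w.get j} := by
    ext ω; simp [cyl]
  rw [this]
  exact MeasurableSet.iInter fun j =>
    measurableSet_eq_fun (measurable_pi_apply (j : ℕ)) measurable_const

lemma mem_cyl_pre_iff {ω ω' : ℕ → Bool} {n : ℕ} :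
    ω' ∈ cyl (pre ω n) ↔ ∀ i < n, ω' i = ω i := by
  constructor
  · intro h i hi
    have := h ⟨i, by rwa [length_pre]⟩
    simpa [pre] using this
  · intro h j
    have hj : (j : ℕ) < (List.map ω (List.range n)).length := j.2
    rw [h j (lt_of_lt_of_eq j.2 (length_pre ω n))]
    change ω j = (List.map ω (List.range n))[(j : ℕ)]
    simp

lemma exists_cyl_pre_subset {U : Set (ℕ → Bool)} (hU : IsOpen U) {ω : ℕ → Bool} (hω : ω ∈ U) :
    ∃ n, cyl (pre ω n) ⊆ U := by
  obtain ⟨I, u, hu, hIu⟩ := isOpen_pi_iff.1 hU ω hω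
  refine ⟨I.sup id + 1, fun ω' hω' => hIu fun i hi => ?_⟩
  rw [mem_cyl_pre_iff.1 hω' i (Nat.lt_succ_of_le (Finset.le_sup (f := id) hi))]
  exact (hu i hi).2

lemma measure_le_sum_cyl (μ : Measure (ℕ → Bool)) {n : ℕ} {S : Finset (List Bool)}
    {A : Set (ℕ → Bool)} (hA : ∀ ω ∈ A, pre ω n ∈ S) : μ A ≤ ∑ w ∈ S, μ (cyl w) := by
  refine (measure_mono fun ω hω => ?_).trans (measure_biUnion_finset_le S cyl)
  exact mem_iUnion₂.2 ⟨_, hA ω hω, mem_cyl_pre ω n⟩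

/-- Domination on cylinders along the points of `E` implies domination on open sets. -/
lemma measure_inter_le_of_cyl {μ ν : Measure (ℕ → Bool)} {E U : Set (ℕ → Bool)} (hU : IsOpen U)
    (h : ∀ ω ∈ E, ∀ n, μ (cyl (pre ω n)) ≤ ν (cyl (pre ω n))) : μ (U ∩ E) ≤ ν U := by
  classical
  set A : ℕ → Set (ℕ → Bool) := fun n => {ω | ω ∈ E ∧ cyl (pre ω n) ⊆ U} with hA
  have hmono : Monotone A := by
    intro m n hmn ω hω
    refine ⟨hω.1, fun ω' hω' => hω.2 ?_⟩
    rw [mem_cyl_pre_iff] at hω' ⊢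
    exact fun i hi => hω' i (hi.trans_le hmn)
  have hsub : U ∩ E ⊆ ⋃ n, A n := by
    rintro ω ⟨hωU, hωE⟩
    obtain ⟨n, hn⟩ := exists_cyl_pre_subset hU hωU
    exact mem_iUnion.2 ⟨n, hωE, hn⟩
  refine (measure_mono hsub).trans ?_
  rw [hmono.measure_iUnion]
  refine iSup_le fun n => ?_
  set S := (words n).filter fun w => cyl w ⊆ U ∧ ∃ ω ∈ E, pre ω n = w with hS
  have hdisj : (S : Set (List Bool)).PairwiseDisjoint cyl := by
    intro w hw w' hw' hne
    refine Set.disjoint_left.2 fun ω h1 h2 => hne ?_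
    have l1 := mem_words.1 (Finset.mem_filter.1 hw).1
    have l2 := mem_words.1 (Finset.mem_filter.1 hw').1
    rw [mem_cyl_iff, l1] at h1
    rw [mem_cyl_iff, l2] at h2
    exact h1.symm.trans h2
  calc μ (A n) ≤ ∑ w ∈ S, μ (cyl w) := measure_le_sum_cyl μ (n := n) fun ω hω =>
        Finset.mem_filter.2 ⟨mem_words.2 (length_pre ω n), hω.2, ω, hω.1, rfl⟩
    _ ≤ ∑ w ∈ S, ν (cyl w) := by
        refine Finset.sum_le_sum fun w hw => ?_
        obtain ⟨-, -, ω, hω, rfl⟩ := Finset.mem_filter.1 hw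
        exact h ω hω n
    _ = ν (⋃ w ∈ S, cyl w) :=
        (measure_biUnion_finset hdisj fun w _ => measurableSet_cyl w).symm
    _ ≤ ν U := measure_mono (iUnion₂_subset fun w hw => (Finset.mem_filter.1 hw).2.1)

lemma measure_inter_eq_zero_of_cyl {μ ν : Measure (ℕ → Bool)} [IsFiniteMeasure ν]
    {E N : Set (ℕ → Bool)} (h : ∀ ω ∈ E, ∀ n, μ (cyl (pre ω n)) ≤ ν (cyl (pre ω n)))
    (hN : ν N = 0) : μ (N ∩ E) = 0 := by
  rw [← nonpos_iff_eq_zero, ← hN, N.measure_eq_iInf_isOpen ν]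
  exact le_iInf₂ fun U hNU => le_iInf fun hU =>
    (measure_mono (inter_subset_inter_left E hNU)).trans (measure_inter_le_of_cyl hU h)

section Measures

variable {x₀ y₀ : ℝ} {p₀ p₁ : ℝ → ℝ}

lemma cylProb_append_singleton (x : ℝ) (w : List Bool) (b : Bool) :
    cylProb x₀ y₀ p₀ p₁ x (w ++ [b]) = cylProb x₀ y₀ p₀ p₁ x w *
      (if b then p₁ (run x₀ y₀ x w) else p₀ (run x₀ y₀ x w)) := by
  induction w generalizing x with
  | nil => simp [cylProb, run]
  | cons a w ih => simp only [List.cons_append, cylProb, run, ih, mul_assoc]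

lemma A1.run_mem (h : A1 x₀ y₀) {x : ℝ} (hx : x ∈ Ioo (0 : ℝ) 1) (w : List Bool) :
    run x₀ y₀ x w ∈ Ioo (0 : ℝ) 1 := by
  induction w generalizing x with
  | nil => exact hx
  | cons b w ih => exact ih (h.fb_mem b hx)

lemma A3.weight_pos (h : A3 p₀ p₁) {x : ℝ} (hx : x ∈ Ioo (0 : ℝ) 1) (b : Bool) :
    0 < if b then p₁ x else p₀ x := by
  obtain ⟨-, h1, -, h2, -⟩ := h.2.2 x (Ioo_subset_Icc_self hx)
  cases b
  · simpa using h1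
  · simpa using h2

lemma cylProb_nonneg (hA1 : A1 x₀ y₀) (hA3 : A3 p₀ p₁) {x : ℝ} (hx : x ∈ Ioo (0 : ℝ) 1)
    (w : List Bool) : 0 ≤ cylProb x₀ y₀ p₀ p₁ x w := by
  induction w generalizing x with
  | nil => exact zero_le_one
  | cons b w ih => exact mul_nonneg (hA3.weight_pos hx b).le (ih (hA1.fb_mem b hx))

lemma A1.abs_coord_run_le (h : A1 x₀ y₀) {x y : ℝ} (hx : x ∈ Ioo (0 : ℝ) 1)
    (hy : y ∈ Ioo (0 : ℝ) 1) (w : List Bool) :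
    |coord (run x₀ y₀ x w) - coord (run x₀ y₀ y w)| ≤ |coord x - coord y| := by
  induction w generalizing x y with
  | nil => exact le_rfl
  | cons b w ih =>
    exact (ih (h.fb_mem b hx) (h.fb_mem b hy)).trans (h.coord_fb_nonexpansive b hx hy)

lemma sum_cylProb_mul_le (hA1 : A1 x₀ y₀) (hA3 : A3 p₀ p₁) {V : ℝ → ℝ} {L r : ℝ} (hL : 0 ≤ L)
    (hV : ∀ x ∈ Ioo (0 : ℝ) 1, ∀ y ∈ Ioo (0 : ℝ) 1, |coord x - coord y| ≤ r →
      p₀ x * (V (f0 x₀ y₀ x) * |coord (f0 x₀ y₀ x) - coord (f0 x₀ y₀ y)|) +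
        p₁ x * (V (f1 x₀ y₀ x) * |coord (f1 x₀ y₀ x) - coord (f1 x₀ y₀ y)|) ≤
      L * (V x * |coord x - coord y|)) (n : ℕ) {x y : ℝ} (hx : x ∈ Ioo (0 : ℝ) 1)
    (hy : y ∈ Ioo (0 : ℝ) 1) (hxy : |coord x - coord y| ≤ r) :
    ∑ w ∈ words n, cylProb x₀ y₀ p₀ p₁ x w *
        (V (run x₀ y₀ x w) * |coord (run x₀ y₀ x w) - coord (run x₀ y₀ y w)|) ≤
      L ^ n * (V x * |coord x - coord y|) := by
  induction n generalizing x y with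
  | zero => simp [words, cylProb, run]
  | succ n ih =>
    have h0 := ih (hA1.fb_mem false hx) (hA1.fb_mem false hy)
      ((hA1.coord_fb_nonexpansive false hx hy).trans hxy)
    have h1 := ih (hA1.fb_mem true hx) (hA1.fb_mem true hy)
      ((hA1.coord_fb_nonexpansive true hx hy).trans hxy)
    have q0 := hA3.weight_pos hx false
    have q1 := hA3.weight_pos hx true
    have hd := mul_le_mul_of_nonneg_left (hV x hx y hy hxy) (pow_nonneg hL n)
    simp only [fb, Bool.false_eq_true, if_false, if_true] at h0 h1 q0 q1
    have h0' := mul_le_mul_of_nonneg_left h0 q0.le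
    have h1' := mul_le_mul_of_nonneg_left h1 q1.le
    rw [sum_words_succ]
    simp only [cylProb, run, fb, Bool.false_eq_true, if_false, if_true, mul_assoc,
      ← Finset.mul_sum]
    rw [pow_succ]
    simp only [mul_assoc] at h0' h1' ⊢
    linarith

/-- For `ℙ_x`-almost every `ω` the orbits of `x` and `y` approach each other exponentially fast. -/
lemma ae_exists_abs_coord_le (hA1 : A1 x₀ y₀) (hA3 : A3 p₀ p₁) {V : ℝ → ℝ} {L r : ℝ}
    (hL : 0 < L) (hL1 : L < 1) (hV2 : ∀ x, 1 / 2 ≤ V x)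
    (hV : ∀ x ∈ Ioo (0 : ℝ) 1, ∀ y ∈ Ioo (0 : ℝ) 1, |coord x - coord y| ≤ r →
      p₀ x * (V (f0 x₀ y₀ x) * |coord (f0 x₀ y₀ x) - coord (f0 x₀ y₀ y)|) +
        p₁ x * (V (f1 x₀ y₀ x) * |coord (f1 x₀ y₀ x) - coord (f1 x₀ y₀ y)|) ≤
      L * (V x * |coord x - coord y|))
    {Pm : ℝ → Measure (ℕ → Bool)} (hPm : IsKernel x₀ y₀ p₀ p₁ Pm) {x y : ℝ}
    (hx : x ∈ Ioo (0 : ℝ) 1) (hy : y ∈ Ioo (0 : ℝ) 1) (hxy : |coord x - coord y| ≤ r) :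
    ∀ᵐ ω ∂Pm x, ∃ K : ℕ, ∀ n, |coord (run x₀ y₀ x (pre ω n)) - coord (run x₀ y₀ y (pre ω n))| ≤
      K * √L ^ n := by
  set t := √L with ht
  have htpos : 0 < t := Real.sqrt_pos.2 hL
  have ht1 : t < 1 := by
    rw [ht, Real.sqrt_lt' one_pos]; simpa using hL1
  have htt : ∀ n, L ^ n = t ^ n * t ^ n := fun n => by
    rw [← mul_pow, Real.mul_self_sqrt hL.le]
  set d : List Bool → ℝ := fun w => |coord (run x₀ y₀ x w) - coord (run x₀ y₀ y w)| with hd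
  set C := 2 * (V x * |coord x - coord y|) with hC
  have hbound : ∀ n, Pm x {ω | t ^ n < d (pre ω n)} ≤ ENNReal.ofReal (C * t ^ n) := by
    intro n
    have htn : 0 < t ^ n := pow_pos htpos n
    refine (measure_le_sum_cyl (Pm x) (n := n) (S := (words n).filter fun w => t ^ n < d w)
      fun ω hω => Finset.mem_filter.2 ⟨mem_words.2 (length_pre ω n), hω⟩).trans ?_
    rw [Finset.sum_congr rfl fun w _ => hPm x hx w,
      ← ENNReal.ofReal_sum_of_nonneg fun w _ => cylProb_nonneg hA1 hA3 hx w]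
    refine ENNReal.ofReal_le_ofReal ?_
    have h1 := sum_cylProb_mul_le hA1 hA3 hL.le hV n hx hy hxy
    have h2 : (∑ w ∈ (words n).filter fun w => t ^ n < d w, cylProb x₀ y₀ p₀ p₁ x w) * t ^ n ≤
        2 * ∑ w ∈ words n, cylProb x₀ y₀ p₀ p₁ x w * (V (run x₀ y₀ x w) * d w) := by
      rw [Finset.sum_mul, Finset.mul_sum]
      refine (Finset.sum_le_sum fun w hw => ?_).trans
        (Finset.sum_le_sum_of_subset_of_nonneg (Finset.filter_subset _ _) fun w _ _ => ?_)
      · have h3 := (Finset.mem_filter.1 hw).2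
        have h4 := hV2 (run x₀ y₀ x w)
        have h5 : t ^ n ≤ 2 * (V (run x₀ y₀ x w) * d w) := by nlinarith
        have h6 := mul_le_mul_of_nonneg_left h5 (cylProb_nonneg hA1 hA3 hx w)
        linarith
      · have h4 : 0 ≤ V (run x₀ y₀ x w) := by linarith [hV2 (run x₀ y₀ x w)]
        have h5 := cylProb_nonneg hA1 hA3 hx w
        have h6 : 0 ≤ d w := abs_nonneg _
        positivity
    rw [htt] at h1
    refine le_of_mul_le_mul_right ?_ htn
    calc _ ≤ _ := h2
      _ ≤ 2 * (t ^ n * t ^ n * (V x * |coord x - coord y|)) := by linarith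
      _ = C * t ^ n * t ^ n := by rw [hC]; ring
  have hsum : ∑' n, Pm x {ω | t ^ n < d (pre ω n)} ≠ ⊤ := by
    refine ne_top_of_le_ne_top ?_ (ENNReal.tsum_le_tsum hbound)
    exact ((summable_geometric_of_lt_one htpos.le ht1).mul_left C).tsum_ofReal_ne_top
  filter_upwards [ae_eventually_notMem hsum] with ω hω
  obtain ⟨N, hN⟩ := eventually_atTop.1 hω
  obtain ⟨K, hK⟩ := exists_nat_ge (max 1 (|coord x - coord y| / t ^ N))
  refine ⟨K, fun n => ?_⟩
  have htn : 0 < t ^ n := pow_pos htpos n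
  rcases le_total N n with h | h
  · have h1 : d (pre ω n) ≤ t ^ n := not_lt.1 (hN n h)
    have h2 : (1 : ℝ) ≤ K := (le_max_left _ _).trans hK
    exact h1.trans (le_mul_of_one_le_left htn.le h2)
  · refine (hA1.abs_coord_run_le hx hy _).trans ?_
    have h2 := (le_max_right _ _).trans hK
    rw [div_le_iff₀ (pow_pos htpos N)] at h2
    refine h2.trans (mul_le_mul_of_nonneg_left ?_ K.cast_nonneg)
    exact pow_le_pow_of_le_one htpos.le ht1.le h

lemma cylProb_le_exp_mul (hA1 : A1 x₀ y₀) (hA3 : A3 p₀ p₁) {β : ℝ → ℝ}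
    (hβ : ∀ t : ℝ, ∀ x ∈ Icc (0 : ℝ) 1, ∀ y ∈ Icc (0 : ℝ) 1, |x - y| ≤ t →
      |p₀ x - p₀ y| ≤ β t ∧ |p₁ x - p₁ y| ≤ β t)
    {p : ℝ} (hp : 0 < p) (hpp : ∀ x ∈ Icc (0 : ℝ) 1, p ≤ p₀ x ∧ p ≤ p₁ x) {s : ℕ → ℝ}
    {x y : ℝ} (hx : x ∈ Ioo (0 : ℝ) 1) (hy : y ∈ Ioo (0 : ℝ) 1) {ω : ℕ → Bool}
    (hω : ∀ n, |coord (run x₀ y₀ x (pre ω n)) - coord (run x₀ y₀ y (pre ω n))| ≤ s n) (n : ℕ) :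
    cylProb x₀ y₀ p₀ p₁ x (pre ω n) ≤
      Real.exp (∑ k ∈ Finset.range n, β (s k) / p) * cylProb x₀ y₀ p₀ p₁ y (pre ω n) := by
  induction n with
  | zero => simp [pre, cylProb]
  | succ n ih =>
    rw [pre_succ, cylProb_append_singleton, cylProb_append_singleton, Finset.sum_range_succ,
      Real.exp_add]
    have hX := hA1.run_mem hx (pre ω n)
    have hY := hA1.run_mem hy (pre ω n)
    set X := run x₀ y₀ x (pre ω n)
    set Y := run x₀ y₀ y (pre ω n)
    have hXY : |X - Y| ≤ s n := (abs_sub_le_abs_coord_sub hX hY).trans (hω n)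
    have hbd := hβ _ X (Ioo_subset_Icc_self hX) Y (Ioo_subset_Icc_self hY) hXY
    have hlow := hpp Y (Ioo_subset_Icc_self hY)
    have hβ0 : 0 ≤ β (s n) := (abs_nonneg _).trans hbd.1
    have step : ∀ u v : ℝ, |u - v| ≤ β (s n) → p ≤ v → u ≤ Real.exp (β (s n) / p) * v := by
      intro u v huv hv
      have h1 := (abs_le.1 huv).2
      have h2 := Real.add_one_le_exp (β (s n) / p)
      have h3 : β (s n) ≤ β (s n) / p * v := by
        rw [div_mul_eq_mul_div, le_div_iff₀ hp]
        exact mul_le_mul_of_nonneg_left hv hβ0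
      have h4 := mul_le_mul_of_nonneg_right h2 (hp.le.trans hv)
      linarith
    have hstep : (if ω n then p₁ X else p₀ X) ≤
        Real.exp (β (s n) / p) * (if ω n then p₁ Y else p₀ Y) := by
      split_ifs
      · exact step _ _ hbd.2 hlow.2
      · exact step _ _ hbd.1 hlow.1
    have h5 := cylProb_nonneg hA1 hA3 hy (pre ω n)
    refine (mul_le_mul ih hstep (hA3.weight_pos hX _).le (by positivity)).trans (le_of_eq ?_)
    ring

lemma absolutelyContinuous_of_ae (hA1 : A1 x₀ y₀) (hA2 : A2 p₀ p₁) (hA3 : A3 p₀ p₁)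
    {Pm : ℝ → Measure (ℕ → Bool)} (hPm : IsKernel x₀ y₀ p₀ p₁ Pm) {t : ℝ} (ht : 0 < t)
    (ht1 : t < 1) {x y : ℝ} (hx : x ∈ Ioo (0 : ℝ) 1) (hy : y ∈ Ioo (0 : ℝ) 1)
    (hae : ∀ᵐ ω ∂Pm x, ∃ K : ℕ, ∀ n,
      |coord (run x₀ y₀ x (pre ω n)) - coord (run x₀ y₀ y (pre ω n))| ≤ K * t ^ n) :
    Pm x ≪ Pm y := by
  obtain ⟨β, hβ, hsum⟩ := hA2
  obtain ⟨p, hp, -, hpp⟩ := hA3.exists_lower_bound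
  set E : ℕ → Set (ℕ → Bool) := fun K => {ω | ∀ n,
    |coord (run x₀ y₀ x (pre ω n)) - coord (run x₀ y₀ y (pre ω n))| ≤ K * t ^ n} with hE
  have hfin : IsFiniteMeasure (Pm y) := by
    refine ⟨?_⟩
    have huniv : cyl [] = univ := eq_univ_of_forall fun ω j => j.elim0
    rw [← huniv, hPm y hy]
    exact ENNReal.ofReal_lt_top
  intro N hN
  have hEK : ∀ K, Pm x (N ∩ E K) = 0 := by
    intro K
    have hS : Summable fun k => β (K * t ^ k) / p := (hsum K K.cast_nonneg t ht ht1).div_const p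
    set M := Real.exp (∑' k, β (K * t ^ k) / p) with hM
    have hfinM : IsFiniteMeasure (ENNReal.ofReal M • Pm y) :=
      Measure.smul_finite _ ENNReal.ofReal_ne_top
    refine measure_inter_eq_zero_of_cyl (ν := ENNReal.ofReal M • Pm y) ?_ (by simp [hN])
    intro ω hω n
    rw [Measure.smul_apply, hPm x hx, hPm y hy, smul_eq_mul,
      ← ENNReal.ofReal_mul (Real.exp_pos _).le]
    refine ENNReal.ofReal_le_ofReal
      ((cylProb_le_exp_mul hA1 hA3 hβ hp hpp hx hy hω n).trans ?_)
    refine mul_le_mul_of_nonneg_right (Real.exp_le_exp.2 ?_) (cylProb_nonneg hA1 hA3 hy _)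
    refine hS.sum_le_tsum _ fun k _ => div_nonneg ?_ hp.le
    have h0 : (0 : ℝ) ∈ Icc (0 : ℝ) 1 := by simp
    exact (abs_nonneg _).trans (hβ _ 0 h0 0 h0 (by simp; positivity)).1
  have hcompl : Pm x (⋃ K, E K)ᶜ = 0 := by
    rw [← mem_ae_iff]
    filter_upwards [hae] with ω hω
    exact mem_iUnion.2 hω
  refine measure_mono_null (t := (⋃ K, N ∩ E K) ∪ (⋃ K, E K)ᶜ) ?_
    (measure_union_null (measure_iUnion_null hEK) hcompl)
  intro ω hω
  by_cases h : ω ∈ ⋃ K, E K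
  · rw [← inter_iUnion]; exact Or.inl ⟨hω, h⟩
  · exact Or.inr h

end Measures

end AM

/-- Lemma 9: with `c` the unique fixed point of `f₀ ∘ f₁` in `[1−x₀, y₀]`, there
is `ρ > 0` such that for all `x, y ∈ (c−ρ, c+ρ)` the measures `ℙ_x` and `ℙ_y` are mutually
absolutely continuous. -/
theorem stmt17 (x₀ y₀ : ℝ) (p₀ p₁ : ℝ → ℝ)
    (hA1 : AM.A1 x₀ y₀) (hA2 : AM.A2 p₀ p₁) (hA3 : AM.A3 p₀ p₁) (hA4 : AM.A4 x₀ y₀ p₀ p₁)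
    (Pm : ℝ → MeasureTheory.Measure (ℕ → Bool)) (hPm : AM.IsKernel x₀ y₀ p₀ p₁ Pm)
    (c : ℝ) (hc : c ∈ Set.Ioo (1 - x₀) y₀) (hfix : AM.f0 x₀ y₀ (AM.f1 x₀ y₀ c) = c)
    (huniq : ∀ c' ∈ Set.Icc (1 - x₀) y₀, AM.f0 x₀ y₀ (AM.f1 x₀ y₀ c') = c' → c' = c) :
    ∃ ρ : ℝ, 0 < ρ ∧ Set.Ioo (c - ρ) (c + ρ) ⊆ Set.Ioo (0:ℝ) 1 ∧
      ∀ x ∈ Set.Ioo (c - ρ) (c + ρ), ∀ y ∈ Set.Ioo (c - ρ) (c + ρ),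
        Pm x ≪ Pm y ∧ Pm y ≪ Pm x := by
  obtain ⟨V, L, r, hL, hL1, hr, hV2, hV⟩ := AM.exists_lyapunov hA1 hA3 hA4
  have hc01 : c ∈ Ioo (0 : ℝ) 1 := by
    obtain ⟨h1, h2, h3, h4⟩ := hA1
    exact ⟨by linarith [hc.1], by linarith [hc.2]⟩
  have hnear : ∀ᶠ x in 𝓝 c, x ∈ Ioo (0 : ℝ) 1 ∧ dist (AM.coord x) (AM.coord c) < r / 2 :=
    Filter.Eventually.and (Ioo_mem_nhds hc01.1 hc01.2)
      (Metric.tendsto_nhds.1 (AM.continuousAt_coord hc01) _ (half_pos hr))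
  obtain ⟨ρ, hρ, hball⟩ := Metric.eventually_nhds_iff_ball.1 hnear
  rw [Real.ball_eq_Ioo] at hball
  have main : ∀ x ∈ Ioo (c - ρ) (c + ρ), ∀ y ∈ Ioo (c - ρ) (c + ρ), Pm x ≪ Pm y := by
    intro x hx y hy
    obtain ⟨hx1, hx2⟩ := hball x hx
    obtain ⟨hy1, hy2⟩ := hball y hy
    have hxy : |AM.coord x - AM.coord y| ≤ r := by
      rw [← Real.dist_eq]
      linarith [dist_triangle_right (AM.coord x) (AM.coord y) (AM.coord c)]
    have hs1 : √L < 1 := by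
      rw [Real.sqrt_lt' one_pos]; simpa using hL1
    exact AM.absolutelyContinuous_of_ae hA1 hA2 hA3 hPm (Real.sqrt_pos.2 hL) hs1 hx1 hy1
      (AM.ae_exists_abs_coord_le hA1 hA3 hL hL1 hV2 hV hPm hx1 hy1 hxy)
  exact ⟨ρ, hρ, fun x hx => (hball x hx).1, fun x hx y hy => ⟨main x hx y hy, main y hy x hx⟩⟩
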